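/- Let G be a finite simple graph with μ(G) < ν(G), let (M, H, H') be a maximum intersection triple in G, and let P be a maximal M,H-alternating path in G of length at least 2. Then P contains at least one edge belonging to M ∖ H'. -/

import Mathlib

open Finset

section Defs
variable {V : Type*}

/-- A matching: a set of edges, pairwise non-adjacent. -/
def IsMatchingSet (G : SimpleGraph V) (M : Finset (Sym2 V)) : Prop :=
  ↑M ⊆ G.edgeSet ∧ ∀ e ∈ M, ∀ f ∈ M, e ≠ f → ∀ v : V, v ∈ e → v ∉ f

/-- A vertex is saturated by a matching if some edge of it is incident to the vertex. -/
def Saturates (M : Finset (Sym2 V)) (v : V) : Prop :=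
  ∃ e ∈ M, v ∈ e

/-- ν(G): maximum size of a matching. -/
noncomputable def nuG (G : SimpleGraph V) : ℕ :=
  sSup {n | ∃ M : Finset (Sym2 V), IsMatchingSet G M ∧ M.card = n}

/-- λ(G): maximum of |H| + |H'| over pairs of disjoint matchings. -/
noncomputable def lamG (G : SimpleGraph V) : ℕ :=
  sSup {n | ∃ H H' : Finset (Sym2 V), IsMatchingSet G H ∧ IsMatchingSet G H' ∧
    Disjoint H H' ∧ H.card + H'.card = n}

/-- Λ(G): set of pairs of disjoint matchings realizing λ(G). -/
def LambdaSet (G : SimpleGraph V) : Set (Finset (Sym2 V) × Finset (Sym2 V)) :=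
  {p | IsMatchingSet G p.1 ∧ IsMatchingSet G p.2 ∧ Disjoint p.1 p.2 ∧
    p.1.card + p.2.card = lamG G}

/-- μ(G): maximum of |H| over pairs (H, H') ∈ Λ(G). -/
noncomputable def muG (G : SimpleGraph V) : ℕ :=
  sSup {n | ∃ p ∈ LambdaSet G, p.1.card = n}

/-- Λ_μ(G): pairs in Λ(G) with |H| = μ(G). -/
def LambdaMuSet (G : SimpleGraph V) : Set (Finset (Sym2 V) × Finset (Sym2 V)) :=
  {p | p ∈ LambdaSet G ∧ p.1.card = muG G}

end Defs

/-- A maximum intersection triple: M a maximum matching, (H, H') ∈ Λ_μ(G),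
|M ∩ (H ∪ H')| is maximized over all such choices, and subject to that,
|M ∩ H| is maximized. -/
def MaxIntersectionTriple {V : Type*} [DecidableEq V] (G : SimpleGraph V)
    (M H H' : Finset (Sym2 V)) : Prop :=
  IsMatchingSet G M ∧ M.card = nuG G ∧ (H, H') ∈ LambdaMuSet G ∧
  (∀ M₂ N₂ N₂' : Finset (Sym2 V), IsMatchingSet G M₂ → M₂.card = nuG G →
    (N₂, N₂') ∈ LambdaMuSet G →
    (M₂ ∩ (N₂ ∪ N₂')).card ≤ (M ∩ (H ∪ H')).card) ∧
  (∀ M₂ N₂ N₂' : Finset (Sym2 V), IsMatchingSet G M₂ → M₂.card = nuG G →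
    (N₂, N₂') ∈ LambdaMuSet G →
    (M₂ ∩ (N₂ ∪ N₂')).card = (M ∩ (H ∪ H')).card →
    (M₂ ∩ N₂).card ≤ (M ∩ H).card)

/-- A list of edges is A,B-alternating: its edges alternately belong to A ∖ B and
to B ∖ A (starting with either). -/
def AltEdges {V : Type*} [DecidableEq V] (A B : Finset (Sym2 V))
    (l : List (Sym2 V)) : Prop :=
  (∀ (i : ℕ) (h : i < l.length),
    if Even i then l.get ⟨i, h⟩ ∈ A \ B else l.get ⟨i, h⟩ ∈ B \ A) ∨
  (∀ (i : ℕ) (h : i < l.length),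
    if Even i then l.get ⟨i, h⟩ ∈ B \ A else l.get ⟨i, h⟩ ∈ A \ B)

/-- A maximal A,B-alternating path: an A,B-alternating path not properly contained
in a longer A,B-alternating path. -/
def IsMaxAltPath {V : Type*} [DecidableEq V] (G : SimpleGraph V)
    (A B : Finset (Sym2 V)) {u v : V} (p : G.Walk u v) : Prop :=
  p.IsPath ∧ AltEdges A B p.edges ∧
  ¬ ∃ (u' v' : V) (q : G.Walk u' v'), q.IsPath ∧ AltEdges A B q.edges ∧
    (∀ e ∈ p.edges, e ∈ q.edges) ∧ p.edges.length < q.edges.length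

section Swap
variable {V : Type*} {G : SimpleGraph V}

theorem IsMatchingSet.eq_of_mem {A : Finset (Sym2 V)} (hA : IsMatchingSet G A)
    {e f : Sym2 V} (he : e ∈ A) (hf : f ∈ A) {x : V} (hxe : x ∈ e) (hxf : x ∈ f) : e = f := by
  by_contra hne
  exact hA.2 e he f hf hne x hxe hxf

theorem IsMatchingSet.card_le_nuG [Fintype V] {A : Finset (Sym2 V)} (hA : IsMatchingSet G A) :
    A.card ≤ nuG G := by
  classical
  refine le_csSup ⟨Fintype.card (Sym2 V), ?_⟩ ⟨A, hA, rfl⟩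
  rintro n ⟨B, -, rfl⟩
  exact Finset.card_le_univ B

theorem card_le_muG [Fintype V] {p : Finset (Sym2 V) × Finset (Sym2 V)} (hp : p ∈ LambdaSet G) :
    p.1.card ≤ muG G := by
  classical
  refine le_csSup ⟨Fintype.card (Sym2 V), ?_⟩ ⟨p, hp, rfl⟩
  rintro n ⟨q, -, rfl⟩
  exact Finset.card_le_univ q.1

variable [DecidableEq V]

/-- The set obtained from `A` by exchanging its edges in `C` for the edges of `B` in `C`. -/
def swapOn (A B C : Finset (Sym2 V)) : Finset (Sym2 V) := (A \ C) ∪ (C ∩ B)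

theorem IsMatchingSet.swapOn {A B C : Finset (Sym2 V)} (hA : IsMatchingSet G A)
    (hB : IsMatchingSet G B)
    (hC : ∀ b ∈ C, b ∈ B → ∀ a ∈ A, ∀ x, x ∈ b → x ∈ a → a ∈ C) :
    IsMatchingSet G (swapOn A B C) := by
  constructor
  · intro e he
    simp only [_root_.swapOn, Finset.coe_union, Set.mem_union, Finset.mem_coe,
      Finset.mem_sdiff, Finset.mem_inter] at he
    rcases he with he | he
    · exact hA.1 he.1
    · exact hB.1 he.2
  · intro e he f hf hne x hxe hxf
    simp only [_root_.swapOn, Finset.mem_union, Finset.mem_sdiff, Finset.mem_inter] at he hf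
    rcases he with he | he <;> rcases hf with hf | hf
    · exact hne (hA.eq_of_mem he.1 hf.1 hxe hxf)
    · exact he.2 (hC f hf.1 hf.2 e he.1 x hxf hxe)
    · exact hf.2 (hC e he.1 he.2 f hf.1 x hxe hxf)
    · exact hne (hB.eq_of_mem he.2 hf.2 hxe hxf)

theorem card_swapOn (A B C : Finset (Sym2 V)) :
    (swapOn A B C).card + (C ∩ A).card = A.card + (C ∩ B).card := by
  have hd : Disjoint (A \ C) (C ∩ B) := by
    rw [Finset.disjoint_left]
    intro e he hf
    exact (Finset.mem_sdiff.1 he).2 (Finset.mem_inter.1 hf).1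
  have h := Finset.card_sdiff_add_card_inter A C
  rw [swapOn, Finset.card_union_of_disjoint hd, Finset.inter_comm C A]
  omega

variable [Fintype V]

/-- In a maximum intersection triple, `M` cannot be exchanged for `H` without loss on a
nontrivial set of edges. -/
theorem MaxIntersectionTriple.not_swappable {M H H' C : Finset (Sym2 V)}
    (ht : MaxIntersectionTriple G M H H') (hdis : ∀ e ∈ C, e ∈ M → e ∉ H)
    (hne : (C ∩ H).Nonempty) (hcard : (C ∩ M).card ≤ (C ∩ H).card)
    (hC : ∀ b ∈ C, b ∈ H → ∀ a ∈ M, ∀ x, x ∈ b → x ∈ a → a ∈ C) : False := by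
  obtain ⟨hM, hMν, hHH', hmax₁, hmax₂⟩ := ht
  have hH : IsMatchingSet G H := hHH'.1.1
  have hswap := hM.swapOn hH hC
  have hν := hswap.card_le_nuG
  have hsc := card_swapOn M H C
  have hcard₂ : (swapOn M H C).card = nuG G := by omega
  have h₁ : swapOn M H C ∩ (H ∪ H') = swapOn (M ∩ (H ∪ H')) H C := by
    ext e; simp only [swapOn, Finset.mem_inter, Finset.mem_union, Finset.mem_sdiff]; tauto
  have h₂ : swapOn M H C ∩ H = swapOn (M ∩ H) H C := by
    ext e; simp only [swapOn, Finset.mem_inter, Finset.mem_union, Finset.mem_sdiff]; tauto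
  have hc₁ := card_swapOn (M ∩ (H ∪ H')) H C
  have hc₂ := card_swapOn (M ∩ H) H C
  have hempty : C ∩ (M ∩ H) = ∅ := by
    ext e; simp only [Finset.mem_inter, Finset.notMem_empty, iff_false]
    rintro ⟨h1, h2, h3⟩
    exact hdis e h1 h2 h3
  have hle : (C ∩ (M ∩ (H ∪ H'))).card ≤ (C ∩ M).card :=
    Finset.card_le_card (Finset.inter_subset_inter_left Finset.inter_subset_left)
  have hpos := hne.card_pos
  have hm₁ := hmax₁ _ _ _ hswap hcard₂ hHH'
  have hm₂ := hmax₂ _ _ _ hswap hcard₂ hHH'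
  rw [h₁] at hm₁ hm₂
  rw [h₂] at hm₂
  rw [hempty, Finset.card_empty] at hc₂
  have := hm₂ (by omega)
  omega

/-- In a maximum intersection triple, `H` and `H'` cannot be exchanged on a set of edges
containing more edges of `H'` than of `H`. -/
theorem MaxIntersectionTriple.card_inter_le {M H H' C : Finset (Sym2 V)}
    (ht : MaxIntersectionTriple G M H H')
    (hC : ∀ b ∈ C, b ∈ H' → ∀ a ∈ H, ∀ x, x ∈ b → x ∈ a → a ∈ C)
    (hC' : ∀ b ∈ C, b ∈ H → ∀ a ∈ H', ∀ x, x ∈ b → x ∈ a → a ∈ C) :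
    (C ∩ H').card ≤ (C ∩ H).card := by
  obtain ⟨-, -, ⟨⟨hH, hH', hdis, hsum⟩, hμ⟩, -, -⟩ := ht
  dsimp only at hH hH' hdis hsum hμ
  have hdis₂ : Disjoint (swapOn H H' C) (swapOn H' H C) := by
    rw [Finset.disjoint_left] at hdis ⊢
    intro e he hf
    simp only [swapOn, Finset.mem_inter, Finset.mem_union, Finset.mem_sdiff] at he hf
    have := @hdis e
    tauto
  have hc := card_swapOn H H' C
  have hc' := card_swapOn H' H C
  have hle := card_le_muG (p := (swapOn H H' C, swapOn H' H C))
    ⟨hH.swapOn hH' hC, hH'.swapOn hH hC', hdis₂, by dsimp only; omega⟩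
  dsimp only at hle
  omega

end Swap

section Alternating
variable {V : Type*} {G : SimpleGraph V}

theorem mem_support_of_mem_edges {u v x : V} {p : G.Walk u v} {e : Sym2 V}
    (he : e ∈ p.edges) (hx : x ∈ e) : x ∈ p.support := by
  obtain ⟨y, rfl⟩ := Sym2.mem_iff_exists.1 hx
  exact p.fst_mem_support_of_mem_edges he

variable [DecidableEq V]

/-- The edges of the list alternate between `A \ B` and `B \ A`, beginning with `A \ B`. -/
def AltFrom : Finset (Sym2 V) → Finset (Sym2 V) → List (Sym2 V) → Prop
  | _, _, [] => True
  | A, B, e :: l => e ∈ A \ B ∧ AltFrom B A l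

theorem altFrom_iff (A B : Finset (Sym2 V)) (l : List (Sym2 V)) :
    AltFrom A B l ↔ ∀ (i : ℕ) (h : i < l.length),
      if Even i then l.get ⟨i, h⟩ ∈ A \ B else l.get ⟨i, h⟩ ∈ B \ A := by
  induction l generalizing A B with
  | nil => simp [AltFrom]
  | cons e l ih =>
    rw [AltFrom, ih]
    constructor
    · rintro ⟨h0, h⟩ (_ | i) hi
      · simpa using h0
      · have := h i (by simpa using hi)
        by_cases hev : Even i <;> simpa [hev, Nat.even_add_one] using this
    · intro h
      refine ⟨by simpa using h 0 (by simp), fun i hi => ?_⟩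
      have := h (i + 1) (by simpa using hi)
      by_cases hev : Even i <;> simpa [hev, Nat.even_add_one] using this

theorem altEdges_iff (A B : Finset (Sym2 V)) (l : List (Sym2 V)) :
    AltEdges A B l ↔ AltFrom A B l ∨ AltFrom B A l := by
  rw [altFrom_iff, altFrom_iff, AltEdges]

theorem AltFrom.mem {A B : Finset (Sym2 V)} {l : List (Sym2 V)} (h : AltFrom A B l)
    {e : Sym2 V} (he : e ∈ l) : e ∈ A \ B ∨ e ∈ B \ A := by
  induction l generalizing A B with
  | nil => simp at he
  | cons f l ih =>
    rcases List.mem_cons.1 he with rfl | he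
    · exact Or.inl h.1
    · exact (ih h.2 he).symm

theorem AltFrom.card {A B : Finset (Sym2 V)} {l : List (Sym2 V)} (h : AltFrom A B l)
    (hl : l.Nodup) :
    (l.toFinset ∩ A).card = (l.toFinset ∩ B).card + l.length % 2 := by
  induction l generalizing A B with
  | nil => simp
  | cons e l ih =>
    have he := Finset.mem_sdiff.1 h.1
    have hl' := List.nodup_cons.1 hl
    have := ih h.2 hl'.2
    rw [List.toFinset_cons, Finset.insert_inter_of_mem he.1, Finset.insert_inter_of_notMem he.2,
      Finset.card_insert_of_notMem (by simp [hl'.1]), List.length_cons]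
    omega

theorem AltFrom.append_singleton {A B : Finset (Sym2 V)} {l : List (Sym2 V)} {f : Sym2 V}
    (h : AltFrom A B l) (hf : if Even l.length then f ∈ A \ B else f ∈ B \ A) :
    AltFrom A B (l ++ [f]) := by
  induction l generalizing A B with
  | nil => simpa [AltFrom] using hf
  | cons e l ih =>
    refine ⟨h.1, ih h.2 ?_⟩
    by_cases hev : Even l.length <;> simpa [hev, Nat.even_add_one] using hf

theorem AltFrom.reverse {A B : Finset (Sym2 V)} {l : List (Sym2 V)} (h : AltFrom A B l) :
    if Even l.length then AltFrom B A l.reverse else AltFrom A B l.reverse := by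
  induction l generalizing A B with
  | nil => simp [AltFrom]
  | cons e l ih =>
    have ih := ih h.2
    have h1 := h.1
    rw [List.reverse_cons]
    by_cases hev : Even l.length
    · simp only [hev, if_true, List.length_cons, Nat.even_add_one, not_true, if_false] at ih ⊢
      exact ih.append_singleton (by simpa [hev] using h1)
    · simp only [hev, if_false, List.length_cons, Nat.even_add_one, not_false_eq_true,
        if_true] at ih ⊢
      exact ih.append_singleton (by simpa [hev] using h1)

theorem AltFrom.exists_start {A B : Finset (Sym2 V)} {u v : V} {p : G.Walk u v}
    (h : AltFrom A B p.edges) (hlen : 0 < p.edges.length) :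
    ∃ e ∈ p.edges, e ∈ A \ B ∧ u ∈ e := by
  cases p with
  | nil => simp at hlen
  | cons hadj q => exact ⟨_, by simp, h.1, Sym2.mem_mk_left _ _⟩

theorem AltFrom.exists_end_of_even {A B : Finset (Sym2 V)} {u v : V} {p : G.Walk u v}
    (h : AltFrom A B p.edges) (hlen : 0 < p.edges.length) (hev : Even p.edges.length) :
    ∃ e ∈ p.edges, e ∈ B \ A ∧ v ∈ e := by
  have hr := h.reverse
  rw [if_pos hev, ← SimpleGraph.Walk.edges_reverse] at hr
  simpa using hr.exists_start (by simpa using hlen)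

theorem AltFrom.exists_end_of_odd {A B : Finset (Sym2 V)} {u v : V} {p : G.Walk u v}
    (h : AltFrom A B p.edges) (hodd : ¬ Even p.edges.length) :
    ∃ e ∈ p.edges, e ∈ A \ B ∧ v ∈ e := by
  have hr := h.reverse
  rw [if_neg hodd, ← SimpleGraph.Walk.edges_reverse] at hr
  have hlen : 0 < p.edges.length := by
    by_contra h0
    exact hodd (by simp [Nat.eq_zero_of_not_pos h0])
  simpa using hr.exists_start (by simpa using hlen)

theorem AltFrom.exists_interior {A B : Finset (Sym2 V)} {u v : V} {p : G.Walk u v}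
    (h : AltFrom A B p.edges) {x : V} (hx : x ∈ p.support) (hxu : x ≠ u) (hxv : x ≠ v) :
    (∃ e ∈ p.edges, e ∈ A \ B ∧ x ∈ e) ∧ ∃ e ∈ p.edges, e ∈ B \ A ∧ x ∈ e := by
  induction p generalizing A B with
  | nil => simp at hx; exact absurd hx hxu
  | @cons a b c hadj q ih =>
    rw [SimpleGraph.Walk.edges_cons] at h ⊢
    have hxq : x ∈ q.support := by simpa [hxu] using hx
    by_cases hxb : x = b
    · subst hxb
      have hlen : 0 < q.edges.length := by
        cases q with
        | nil => exact absurd rfl hxv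
        | cons _ _ => simp
      obtain ⟨e, he, heB, hxe⟩ := AltFrom.exists_start h.2 hlen
      exact ⟨⟨_, List.mem_cons_self, h.1, Sym2.mem_mk_right _ _⟩,
        ⟨e, List.mem_cons_of_mem _ he, heB, hxe⟩⟩
    · obtain ⟨⟨e, he, he'⟩, f, hf, hf'⟩ := ih h.2 hxq hxb hxv
      exact ⟨⟨f, List.mem_cons_of_mem _ hf, hf'⟩, ⟨e, List.mem_cons_of_mem _ he, he'⟩⟩

theorem IsMaxAltPath.swap {A B : Finset (Sym2 V)} {u v : V} {p : G.Walk u v}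
    (hp : IsMaxAltPath G A B p) : IsMaxAltPath G B A p := by
  have hc : ∀ l, AltEdges A B l ↔ AltEdges B A l := fun l => or_comm
  simpa only [IsMaxAltPath, hc] using hp

theorem IsMaxAltPath.reverse {A B : Finset (Sym2 V)} {u v : V} {p : G.Walk u v}
    (hp : IsMaxAltPath G A B p) : IsMaxAltPath G A B p.reverse := by
  obtain ⟨h1, h2, h3⟩ := hp
  refine ⟨h1.reverse, ?_, by simpa using h3⟩
  rw [altEdges_iff, SimpleGraph.Walk.edges_reverse]
  rw [altEdges_iff] at h2
  rcases h2 with h | h <;> have := h.reverse <;> split_ifs at this <;> tauto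

/-- At the start of a maximal alternating path, an edge of the matching missing there can
only be the edge closing the path to a cycle. -/
theorem IsMaxAltPath.mem_or_eq_start {A B : Finset (Sym2 V)} {u v : V} {p : G.Walk u v}
    (hp : IsMaxAltPath G A B p) (hA : IsMatchingSet G A) (hB : IsMatchingSet G B)
    (h : AltFrom A B p.edges) (hlen : 0 < p.edges.length) {f : Sym2 V} (hf : f ∈ B)
    (huf : u ∈ f) : f ∈ p.edges ∨ (f = s(u, v) ∧ ¬ Even p.edges.length) := by
  obtain ⟨e, he, heA, hue⟩ := h.exists_start hlen
  rw [Finset.mem_sdiff] at heA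
  have hfA : f ∉ A := fun hfA => heA.2 (hA.eq_of_mem hfA heA.1 huf hue ▸ hf)
  obtain ⟨w, rfl⟩ := Sym2.mem_iff_exists.1 huf
  have hadj : G.Adj u w := hB.1 hf
  by_cases hw : w ∈ p.support
  · by_cases hwv : w = v
    · subst hwv
      by_cases hev : Even p.edges.length
      · obtain ⟨b, hb, hbB, hwb⟩ := h.exists_end_of_even hlen hev
        left
        rwa [hB.eq_of_mem hf (Finset.mem_sdiff.1 hbB).1 (Sym2.mem_mk_right _ _) hwb]
      · exact Or.inr ⟨rfl, hev⟩
    · obtain ⟨-, b, hb, hbB, hwb⟩ := h.exists_interior hw hadj.ne' hwv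
      left
      rwa [hB.eq_of_mem hf (Finset.mem_sdiff.1 hbB).1 (Sym2.mem_mk_right _ _) hwb]
  · exfalso
    refine hp.2.2 ⟨w, v, SimpleGraph.Walk.cons hadj.symm p, hp.1.cons hw, ?_, ?_, by simp⟩
    · rw [altEdges_iff]
      right
      refine ⟨?_, h⟩
      change s(w, u) ∈ B \ A
      rw [Sym2.eq_swap]
      exact Finset.mem_sdiff.2 ⟨hf, hfA⟩
    · intro e he
      simp [he]

theorem IsMaxAltPath.mem_or_eq_end {A B : Finset (Sym2 V)} {u v : V} {p : G.Walk u v}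
    (hp : IsMaxAltPath G A B p) (hA : IsMatchingSet G A) (hB : IsMatchingSet G B)
    (h : AltFrom A B p.edges) (hodd : ¬ Even p.edges.length) {f : Sym2 V} (hf : f ∈ B)
    (hvf : v ∈ f) : f ∈ p.edges ∨ f = s(u, v) := by
  have hlen : 0 < p.edges.length := by
    by_contra h0
    exact hodd (by simp [Nat.eq_zero_of_not_pos h0])
  have hr := h.reverse
  rw [if_neg hodd, ← SimpleGraph.Walk.edges_reverse] at hr
  have := hp.reverse.mem_or_eq_start hA hB hr (by simpa using hlen) hf hvf
  rw [Sym2.eq_swap] at this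
  simpa [hodd] using this.imp_right And.left

/-- On an alternating path starting and ending in `A`, each vertex lies on an edge of `A`. -/
theorem AltFrom.exists_of_odd {A B : Finset (Sym2 V)} {u v : V} {p : G.Walk u v}
    (h : AltFrom A B p.edges) (hodd : ¬ Even p.edges.length) {x : V} (hx : x ∈ p.support) :
    ∃ e ∈ p.edges, e ∈ A \ B ∧ x ∈ e := by
  by_cases hxv : x = v
  · subst hxv
    exact h.exists_end_of_odd hodd
  by_cases hxu : x = u
  · subst hxu
    refine h.exists_start ?_
    by_contra h0
    exact hodd (by simp [Nat.eq_zero_of_not_pos h0])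
  · exact (h.exists_interior hx hxu hxv).1

/-- For a maximal alternating path starting and ending in `A`, an edge of `B` meeting it
lies on it or closes it to a cycle. -/
theorem IsMaxAltPath.mem_or_eq_of_odd {A B : Finset (Sym2 V)} {u v : V} {p : G.Walk u v}
    (hp : IsMaxAltPath G A B p) (hA : IsMatchingSet G A) (hB : IsMatchingSet G B)
    (h : AltFrom A B p.edges) (hodd : ¬ Even p.edges.length) {f : Sym2 V} (hf : f ∈ B)
    {x : V} (hx : x ∈ p.support) (hxf : x ∈ f) : f ∈ p.edges ∨ f = s(u, v) := by
  by_cases hxv : x = v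
  · subst hxv
    exact hp.mem_or_eq_end hA hB h hodd hf hxf
  by_cases hxu : x = u
  · subst hxu
    refine (hp.mem_or_eq_start hA hB h ?_ hf hxf).imp_right And.left
    by_contra h0
    exact hodd (by simp [Nat.eq_zero_of_not_pos h0])
  · obtain ⟨-, b, hb, hbB, hxb⟩ := h.exists_interior hx hxu hxv
    left
    rwa [hB.eq_of_mem hf (Finset.mem_sdiff.1 hbB).1 hxf hxb]

variable [Fintype V]

theorem MaxIntersectionTriple.not_even_length {M H H' : Finset (Sym2 V)}
    (ht : MaxIntersectionTriple G M H H') {u v : V} {p : G.Walk u v}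
    (hp : IsMaxAltPath G M H p) (hlen : 0 < p.edges.length) (h : AltFrom H M p.edges) :
    ¬ Even p.edges.length := by
  intro hev
  have hM := ht.1
  have hH := ht.2.2.1.1.1
  have hcard := h.card hp.1.isTrail.edges_nodup
  refine ht.not_swappable (C := p.edges.toFinset) ?_ ?_ (by omega) ?_
  · intro e he
    have := h.mem (List.mem_toFinset.1 he)
    simp only [Finset.mem_sdiff] at this
    tauto
  · obtain ⟨e, he, heH, -⟩ := h.exists_start hlen
    exact ⟨e, by simp [he, (Finset.mem_sdiff.1 heH).1]⟩
  · intro b hb hbH a haM x hxb hxa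
    rw [List.mem_toFinset] at hb ⊢
    have hx := mem_support_of_mem_edges hb hxb
    by_cases hxu : x = u
    · subst hxu
      exact (hp.swap.mem_or_eq_start hH hM h hlen haM hxa).resolve_right fun hc => hc.2 hev
    · obtain ⟨e, he, heM, hxe⟩ : ∃ e ∈ p.edges, e ∈ M \ H ∧ x ∈ e := by
        by_cases hxv : x = v
        · subst hxv
          exact h.exists_end_of_even hlen hev
        · exact (h.exists_interior hx hxu hxv).2
      rwa [hM.eq_of_mem haM (Finset.mem_sdiff.1 heM).1 hxa hxe]

theorem MaxIntersectionTriple.even_length {M H H' : Finset (Sym2 V)}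
    (ht : MaxIntersectionTriple G M H H') {u v : V} {p : G.Walk u v}
    (hp : IsMaxAltPath G M H p) (h : AltFrom H M p.edges) :
    Even p.edges.length := by
  by_contra hodd
  have hM := ht.1
  have hH := ht.2.2.1.1.1
  have hcard := h.card hp.1.isTrail.edges_nodup
  rw [Nat.not_even_iff.1 hodd] at hcard
  obtain ⟨e₀, he₀, heH₀, hue₀⟩ := h.exists_of_odd hodd p.start_mem_support
  rw [Finset.mem_sdiff] at heH₀
  have hmem : ∀ e ∈ p.edges, (e ∈ H ∧ e ∉ M) ∨ (e ∈ M ∧ e ∉ H) := by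
    intro e he
    simpa only [Finset.mem_sdiff] using h.mem he
  refine ht.not_swappable (C := p.edges.toFinset ∪ ({s(u, v)} ∩ M)) ?_ ?_ ?_ ?_
  · intro e he heM heH
    simp only [Finset.mem_union, List.mem_toFinset, Finset.mem_inter,
      Finset.mem_singleton] at he
    rcases he with he | ⟨rfl, -⟩
    · have := hmem e he
      tauto
    · exact heH₀.2 (hH.eq_of_mem heH heH₀.1 (Sym2.mem_mk_left _ _) hue₀ ▸ heM)
  · exact ⟨e₀, by simp [he₀, heH₀.1]⟩
  · have h1 : (p.edges.toFinset ∪ ({s(u, v)} ∩ M)) ∩ M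
        ⊆ (p.edges.toFinset ∩ M) ∪ {s(u, v)} := by
      intro e; simp only [Finset.mem_union, Finset.mem_inter]; tauto
    have h2 : p.edges.toFinset ∩ H ⊆ (p.edges.toFinset ∪ ({s(u, v)} ∩ M)) ∩ H :=
      Finset.inter_subset_inter_right Finset.subset_union_left
    have h3 := Finset.card_union_le (p.edges.toFinset ∩ M) {s(u, v)}
    rw [Finset.card_singleton] at h3
    have h4 := Finset.card_le_card h1
    have h5 := Finset.card_le_card h2
    omega
  · intro b hb hbH a haM x hxb hxa
    have hx : x ∈ p.support := by
      simp only [Finset.mem_union, List.mem_toFinset, Finset.mem_inter,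
        Finset.mem_singleton] at hb
      rcases hb with hb | ⟨rfl, -⟩
      · exact mem_support_of_mem_edges hb hxb
      · rcases Sym2.mem_iff.1 hxb with rfl | rfl <;> simp
    have := hp.swap.mem_or_eq_of_odd hH hM h hodd haM hx hxa
    simp only [Finset.mem_union, List.mem_toFinset, Finset.mem_inter, Finset.mem_singleton]
    tauto

/-- A maximal alternating path starting and ending in `M` does not close to a cycle. -/
theorem MaxIntersectionTriple.not_closing {M H H' : Finset (Sym2 V)}
    (ht : MaxIntersectionTriple G M H H') {u v : V} {p : G.Walk u v}
    (hp : IsMaxAltPath G M H p) (h : AltFrom M H p.edges) (hodd : ¬ Even p.edges.length) :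
    s(u, v) ∉ H ∨ s(u, v) ∈ p.edges := by
  by_contra! hc
  obtain ⟨hcH, hcp⟩ := hc
  have hM := ht.1
  have hcard := h.card hp.1.isTrail.edges_nodup
  rw [Nat.not_even_iff.1 hodd] at hcard
  obtain ⟨e₀, he₀, heM₀, hue₀⟩ := h.exists_of_odd hodd p.start_mem_support
  rw [Finset.mem_sdiff] at heM₀
  have hcM : s(u, v) ∉ M := fun hcM =>
    hcp (hM.eq_of_mem hcM heM₀.1 (Sym2.mem_mk_left _ _) hue₀ ▸ he₀)
  refine ht.not_swappable (C := insert s(u, v) p.edges.toFinset) ?_ ?_ ?_ ?_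
  · intro e he heM heH
    rcases Finset.mem_insert.1 he with rfl | he
    · exact hcM heM
    · have := h.mem (List.mem_toFinset.1 he)
      simp only [Finset.mem_sdiff] at this
      tauto
  · exact ⟨s(u, v), by simp [hcH]⟩
  · rw [Finset.insert_inter_of_mem hcH, Finset.insert_inter_of_notMem hcM,
      Finset.card_insert_of_notMem (by simp [hcp])]
    omega
  · intro b hb hbH a haM x hxb hxa
    have hx : x ∈ p.support := by
      rcases Finset.mem_insert.1 hb with rfl | hb
      · rcases Sym2.mem_iff.1 hxb with rfl | rfl <;> simp
      · exact mem_support_of_mem_edges (List.mem_toFinset.1 hb) hxb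
    obtain ⟨e, he, heM, hxe⟩ := h.exists_of_odd hodd hx
    rw [hM.eq_of_mem haM (Finset.mem_sdiff.1 heM).1 hxa hxe]
    simp [he]

end Alternating

/-- For a maximum intersection triple with μ(G) < ν(G), every maximal
M,H-alternating path of length at least 2 contains an edge of M ∖ H'. -/
theorem stmt16 {V : Type*} [Fintype V] [DecidableEq V] (G : SimpleGraph V)
    (hratio : muG G < nuG G) (M H H' : Finset (Sym2 V))
    (ht : MaxIntersectionTriple G M H H')
    (u v : V) (p : G.Walk u v) (hp : IsMaxAltPath G M H p)
    (hlen : 2 ≤ p.edges.length) :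
    ∃ e ∈ p.edges, e ∈ M ∧ e ∉ H' := by
  have hH := ht.2.2.1.1.1
  have hH' := ht.2.2.1.1.2.1
  have hdis := Finset.disjoint_left.1 ht.2.2.1.1.2.2.1
  have hpos : 0 < p.edges.length := by omega
  have hnot : ∀ {a b : V} (q : G.Walk a b), IsMaxAltPath G M H q → 0 < q.edges.length →
      ¬ AltFrom H M q.edges :=
    fun q hq hql hqa => ht.not_even_length hq hql hqa (ht.even_length hq hqa)
  have h : AltFrom M H p.edges :=
    ((altEdges_iff M H _).1 hp.2.1).resolve_right (hnot p hp hpos)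
  have hodd : ¬ Even p.edges.length := by
    intro hev
    refine hnot p.reverse hp.reverse (by simpa using hpos) ?_
    have hr := h.reverse
    rwa [if_pos hev, ← SimpleGraph.Walk.edges_reverse] at hr
  have hclose := ht.not_closing hp h hodd
  by_contra! hsub
  have hcard := h.card hp.1.isTrail.edges_nodup
  rw [Nat.not_even_iff.1 hodd] at hcard
  have hle := ht.card_inter_le (C := p.edges.toFinset) ?_ ?_
  · have : p.edges.toFinset ∩ M ⊆ p.edges.toFinset ∩ H' := by
      intro e he
      simp only [Finset.mem_inter, List.mem_toFinset] at he ⊢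
      exact ⟨he.1, hsub e he.1 he.2⟩
    have := Finset.card_le_card this
    omega
  · intro b hb _ a haH x hxb hxa
    rw [List.mem_toFinset] at hb ⊢
    rcases hp.mem_or_eq_of_odd ht.1 hH h hodd haH (mem_support_of_mem_edges hb hxb) hxa
      with ha | rfl
    · exact ha
    · exact hclose.resolve_left (not_not.2 haH)
  · intro b hb _ a haH' x hxb hxa
    rw [List.mem_toFinset] at hb ⊢
    obtain ⟨e, he, heM, hxe⟩ := h.exists_of_odd hodd (mem_support_of_mem_edges hb hxb)
    rwa [hH'.eq_of_mem haH' (hsub e he (Finset.mem_sdiff.1 heM).1) hxa hxe]
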